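/- Double-sum expansion of the variance of the time-(K+1) component of the working-MSM efficient influence function with binary outcome: σ²_{K+1} := E_p[ C² · (y(l_{K+1}) − Q̄(ā(K), l̄(K)))² ] = Σ_{d1∈𝒟} Σ_{d2∈𝒟} h(d1,K+1) h(d2,K+1) · E_p[ 1{ā(K) = d1(l̄(K))} · 1{d1(l̄(K)) = d2(l̄(K))} · Q̄(1 − Q̄)(ā(K), l̄(K)) / g_{0:K}(ā(K), l̄(K))² ]. -/

import Mathlib

/-!
Longitudinal data with a binary final outcome: `O = (l̄(K), ā(K), Y)` with `Y : Bool`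
(`y(true) = 1`, `y(false) = 0`), full-support pmf `p`, treatment mechanism factors `g_t`,
covariate factors `q_t`, outcome regression `Q̄(ā(K), l̄(K)) = q_{K+1}(true ∣ l̄(K), ā(K))`,
a finite family `𝒟` of regimens with weights `h(·, K+1)`, and the time-`(K+1)` component
`D*_{K+1} = C · (y - Q̄)` of the working-MSM efficient influence function.
-/

open Finset
open scoped Classical

noncomputable section

variable {K : ℕ} {L : Fin (K + 1) → Type} {A : Fin (K + 1) → Type}

/-- Covariate histories `l̄(K)`. -/
abbrev Cov (K : ℕ) (L : Fin (K + 1) → Type) : Type := ∀ s : Fin (K + 1), L s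

/-- Treatment histories `ā(K)`. -/
abbrev Trt (K : ℕ) (A : Fin (K + 1) → Type) : Type := ∀ s : Fin (K + 1), A s

/-- Observations `(l̄(K), ā(K), Y)` with binary outcome `Y`. -/
abbrev Obs (K : ℕ) (L : Fin (K + 1) → Type) (A : Fin (K + 1) → Type) : Type :=
  Cov K L × Trt K A × Bool

/-- Agreement of covariate histories on indices `< t`. -/
def aL (t : ℕ) (l l' : Cov K L) : Prop := ∀ s : Fin (K + 1), (s : ℕ) < t → l s = l' s

/-- Agreement of treatment histories on indices `< t`. -/
def aA (t : ℕ) (a a' : Trt K A) : Prop := ∀ s : Fin (K + 1), (s : ℕ) < t → a s = a' s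

variable [∀ t, Fintype (L t)] [∀ t, Fintype (A t)]

/-- Mass of the event that covariates agree with `l` on indices `< tL` and treatments agree
with `a` on indices `< tA`. -/
def marg (p : Obs K L A → ℝ) (tL tA : ℕ) (l : Cov K L) (a : Trt K A) : ℝ :=
  ∑ o' : Obs K L A, if aL tL l o'.1 ∧ aA tA a o'.2.1 then p o' else 0

/-- Mass of the event that covariates and treatments agree with `(l, a)` everywhere and the
binary outcome equals `true`. -/
def margY (p : Obs K L A → ℝ) (l : Cov K L) (a : Trt K A) : ℝ :=
  ∑ o' : Obs K L A,
    if aL (K + 1) l o'.1 ∧ aA (K + 1) a o'.2.1 ∧ o'.2.2 = true then p o' else 0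

/-- The outcome regression `Q̄(ā(K), l̄(K)) = q_{K+1}(true ∣ l̄(K), ā(K))`. -/
def Qb (p : Obs K L A → ℝ) (l : Cov K L) (a : Trt K A) : ℝ :=
  margY p l a / marg p (K + 1) (K + 1) l a

/-- The conditional factor `q_t(l_t ∣ l̄(t-1), ā(t-1))` (for `t ≤ K`). -/
def qC (p : Obs K L A → ℝ) (t : ℕ) (l : Cov K L) (a : Trt K A) : ℝ :=
  marg p (t + 1) t l a / marg p t t l a

/-- The treatment mechanism factor `g_t(a_t ∣ l̄(t), ā(t-1))`. -/
def gC (p : Obs K L A → ℝ) (t : ℕ) (l : Cov K L) (a : Trt K A) : ℝ :=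
  marg p (t + 1) (t + 1) l a / marg p (t + 1) t l a

/-- The cumulative treatment probability `g_{0:t-1}`; `g_{0:K} = gCum p (K + 1)`. -/
def gCum (p : Obs K L A → ℝ) (t : ℕ) (l : Cov K L) (a : Trt K A) : ℝ :=
  ∏ m ∈ Finset.range t, gC p m l a

/-- The treatment history determined by the regimen `d` along the covariates `l`. -/
def aOf (d : ∀ t : Fin (K + 1), Cov K L → A t) (l : Cov K L) : Trt K A := fun s => d s l

/-- A regimen is adapted: `d_t` depends only on `l̄(t)`. -/
def Adapted (d : ∀ t : Fin (K + 1), Cov K L → A t) : Prop :=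
  ∀ t : Fin (K + 1), ∀ l l' : Cov K L, aL ((t : ℕ) + 1) l l' → d t l = d t l'

/-- The event `ā(K) = d(l̄(K))`. -/
def followsAll (d : ∀ t : Fin (K + 1), Cov K L → A t) (l : Cov K L) (a : Trt K A) : Prop :=
  ∀ s : Fin (K + 1), a s = d s l

/-- The real-valued binary outcome: `y(true) = 1`, `y(false) = 0`. -/
def yB (b : Bool) : ℝ := if b then 1 else 0

/-- The weight `C(ā(K), l̄(K)) = Σ_{d ∈ 𝒟} h(d,K+1) 1{ā(K) = d(l̄(K))} / g_{0:K}(ā(K), l̄(K))`. -/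
def Cw {D : Type} [Fintype D] (p : Obs K L A → ℝ)
    (ds : D → ∀ t : Fin (K + 1), Cov K L → A t) (h : D → ℝ)
    (l : Cov K L) (a : Trt K A) : ℝ :=
  ∑ i : D, h i * ((if followsAll (ds i) l a then (1 : ℝ) else 0) / gCum p (K + 1) l a)

/-- The G-computation mass `P^d_K(l̄(K)) = Π_{m=0}^{K} q_m(l_m ∣ l̄(m-1), d(l̄(m-1)))`. -/
def PdK (p : Obs K L A → ℝ) (d : ∀ t : Fin (K + 1), Cov K L → A t) (l : Cov K L) : ℝ :=
  ∏ m ∈ Finset.range (K + 1), qC p m l (aOf d l)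

theorem aL_full_iff (l l' : Cov K L) : aL (K + 1) l l' ↔ l = l' :=
  ⟨fun h => funext fun s => h s s.isLt, fun h s _ => congrFun h s⟩

theorem aA_full_iff (a a' : Trt K A) : aA (K + 1) a a' ↔ a = a' :=
  ⟨fun h => funext fun s => h s s.isLt, fun h s _ => congrFun h s⟩

theorem marg_full (p : Obs K L A → ℝ) (l : Cov K L) (a : Trt K A) :
    marg p (K + 1) (K + 1) l a = p (l, a, true) + p (l, a, false) := by
  simp [marg, aL_full_iff, aA_full_iff, Fintype.sum_prod_type, ite_and, Finset.sum_add_distrib]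

theorem margY_eq (p : Obs K L A → ℝ) (l : Cov K L) (a : Trt K A) :
    margY p l a = p (l, a, true) := by
  simp [margY, aL_full_iff, aA_full_iff, Fintype.sum_prod_type, ite_and]

/-- The conditional variance of the binary outcome given the full history is `Q̄ (1 - Q̄)`. -/
theorem sum_mul_sq_sub_Qb (p : Obs K L A → ℝ) (hp : ∀ o, 0 < p o) (l : Cov K L) (a : Trt K A) :
    ∑ b : Bool, p (l, a, b) * (yB b - Qb p l a) ^ 2
      = ∑ b : Bool, p (l, a, b) * (Qb p l a * (1 - Qb p l a)) := by
  have hne : p (l, a, true) + p (l, a, false) ≠ 0 := (add_pos (hp _) (hp _)).ne'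
  simp only [Fintype.sum_bool, yB, Qb, marg_full, margY_eq, if_true, Bool.false_eq_true, if_false]
  field_simp
  ring

/-- Under expectation, the squared outcome residual times a function of the full history may be
replaced by the conditional variance. -/
theorem sum_mul_weight_sq_sub_Qb (p : Obs K L A → ℝ) (hp : ∀ o, 0 < p o)
    (w : Cov K L → Trt K A → ℝ) :
    ∑ o : Obs K L A, p o * (w o.1 o.2.1 * (yB o.2.2 - Qb p o.1 o.2.1) ^ 2)
      = ∑ o : Obs K L A, p o * (w o.1 o.2.1 * (Qb p o.1 o.2.1 * (1 - Qb p o.1 o.2.1))) := by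
  rw [Fintype.sum_prod_type, Fintype.sum_prod_type]
  refine Finset.sum_congr rfl fun l _ => ?_
  rw [Fintype.sum_prod_type, Fintype.sum_prod_type]
  refine Finset.sum_congr rfl fun a _ => ?_
  simp only [mul_left_comm _ (w l a), ← Finset.mul_sum, sum_mul_sq_sub_Qb p hp l a]

theorem followsAll_indicator_mul (d d' : ∀ t : Fin (K + 1), Cov K L → A t)
    (l : Cov K L) (a : Trt K A) :
    (if followsAll d l a then (1 : ℝ) else 0) * (if followsAll d' l a then (1 : ℝ) else 0)
      = (if followsAll d l a then (1 : ℝ) else 0) *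
          (if (∀ s : Fin (K + 1), d s l = d' s l) then (1 : ℝ) else 0) := by
  by_cases hd : followsAll d l a
  · have hiff : followsAll d' l a ↔ ∀ s : Fin (K + 1), d s l = d' s l :=
      forall_congr' fun s => by rw [hd s]
    simp only [hiff]
  · simp [hd]

theorem Cw_sq {D : Type} [Fintype D] (p : Obs K L A → ℝ)
    (ds : D → ∀ t : Fin (K + 1), Cov K L → A t) (h : D → ℝ) (l : Cov K L) (a : Trt K A) :
    Cw p ds h l a ^ 2 = ∑ i : D, ∑ j : D, h i * h j *
      ((if followsAll (ds i) l a then (1 : ℝ) else 0) *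
        (if (∀ s : Fin (K + 1), ds i s l = ds j s l) then (1 : ℝ) else 0) /
          gCum p (K + 1) l a ^ 2) := by
  rw [sq, Cw, Finset.sum_mul_sum]
  refine Finset.sum_congr rfl fun i _ => Finset.sum_congr rfl fun j _ => ?_
  rw [← followsAll_indicator_mul]
  ring

/-- double-sum expansion of the variance of the time-`(K+1)` component
`D*_{K+1} = C (y - Q̄)` of the working-MSM efficient influence function with binary outcome. -/
theorem msm_last_component_double_sum [∀ t, Nonempty (L t)] [∀ t, Nonempty (A t)]
    {D : Type} [Fintype D] [Nonempty D]
    (p : Obs K L A → ℝ) (hp : ∀ o, 0 < p o) (hp1 : ∑ o : Obs K L A, p o = 1)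
    (ds : D → ∀ t : Fin (K + 1), Cov K L → A t) (hds : ∀ i, Adapted (ds i))
    (h : D → ℝ) :
    ∑ o : Obs K L A, p o * (Cw p ds h o.1 o.2.1 ^ 2 * (yB o.2.2 - Qb p o.1 o.2.1) ^ 2)
      = ∑ i : D, ∑ j : D, h i * h j *
          ∑ o : Obs K L A, p o *
            ((if followsAll (ds i) o.1 o.2.1 then (1 : ℝ) else 0) *
              (if (∀ s : Fin (K + 1), ds i s o.1 = ds j s o.1) then (1 : ℝ) else 0) *
              (Qb p o.1 o.2.1 * (1 - Qb p o.1 o.2.1)) / gCum p (K + 1) o.1 o.2.1 ^ 2) := by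
  rw [sum_mul_weight_sq_sub_Qb p hp fun l a => Cw p ds h l a ^ 2]
  simp only [Cw_sq, Finset.mul_sum, Finset.sum_mul]
  rw [Finset.sum_comm]
  refine Finset.sum_congr rfl fun i _ => ?_
  rw [Finset.sum_comm]
  refine Finset.sum_congr rfl fun j _ => Finset.sum_congr rfl fun o _ => ?_
  ring

end
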